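/- arXiv:1809.03424 — 2 statements merged into one kernel-verified Lean document; each statement's English description precedes it below -/
import Mathlib

section
/- Let p, q, r, s, t, u be integers with p ≠ 0 and s ≠ 0, and define V(n) = p⌊nφ⌋ + qn + r and W(n) = s⌊nφ⌋ + tn + u for n ≥ 1. Suppose V and W are strictly increasing and V(1) = 1. Then V and W are complementary if and only if (p,q,r,s,t,u) = (1,0,0,1,1,0) or (p,q,r,s,t,u) = (−1,3,−1,1,2,0). -/
noncomputable def phi : ℝ := (1 + Real.sqrt 5) / 2

/-- Two sequences (indexed by `n ≥ 1`) are complementary if their value sets are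
disjoint and their union is the set of positive integers. -/
def ComplementaryPair (V W : ℕ → ℤ) : Prop :=
  Disjoint {z : ℤ | ∃ n : ℕ, 1 ≤ n ∧ V n = z} {z : ℤ | ∃ n : ℕ, 1 ≤ n ∧ W n = z} ∧
  {z : ℤ | ∃ n : ℕ, 1 ≤ n ∧ V n = z} ∪ {z : ℤ | ∃ n : ℕ, 1 ≤ n ∧ W n = z} = {z : ℤ | 0 < z}

lemma phi_eq_goldenRatio : phi = Real.goldenRatio := rfl

lemma phi_mul_self : phi * phi = phi + 1 := by
  rw [phi_eq_goldenRatio, ← sq, Real.goldenRatio_sq]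

lemma irrational_phi : Irrational phi := Real.goldenRatio_irrational

lemma phi_bounds : 1.618 < phi ∧ phi < 1.6181 := by
  have h0 : 0 < phi := Real.goldenRatio_pos
  constructor <;> nlinarith [phi_mul_self]

lemma floor_succ_mul_phi (k : ℕ) :
    ⌊((k + 1 : ℕ) : ℝ) * phi⌋ = ⌊(k : ℝ) * phi⌋ + 1 ∨
      ⌊((k + 1 : ℕ) : ℝ) * phi⌋ = ⌊(k : ℝ) * phi⌋ + 2 := by
  obtain ⟨h1, h2⟩ := phi_bounds
  have hk1 := Int.floor_le ((k : ℝ) * phi)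
  have hk2 := Int.lt_floor_add_one ((k : ℝ) * phi)
  have hs1 : ⌊(k : ℝ) * phi⌋ + 1 ≤ ⌊((k + 1 : ℕ) : ℝ) * phi⌋ := by
    rw [Int.le_floor]; push_cast; linarith
  have hs2 : ⌊((k + 1 : ℕ) : ℝ) * phi⌋ < ⌊(k : ℝ) * phi⌋ + 3 := by
    rw [Int.floor_lt]; push_cast; linarith
  omega

lemma floor_add_three_mul_phi (k : ℕ) :
    ⌊(k : ℝ) * phi⌋ + 4 ≤ ⌊((k + 3 : ℕ) : ℝ) * phi⌋ ∧
      ⌊((k + 3 : ℕ) : ℝ) * phi⌋ ≤ ⌊(k : ℝ) * phi⌋ + 5 := by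
  obtain ⟨h1, h2⟩ := phi_bounds
  have hk1 := Int.floor_le ((k : ℝ) * phi)
  have hk2 := Int.lt_floor_add_one ((k : ℝ) * phi)
  have hs1 : ⌊(k : ℝ) * phi⌋ + 4 ≤ ⌊((k + 3 : ℕ) : ℝ) * phi⌋ := by
    rw [Int.le_floor]; push_cast; linarith
  have hs2 : ⌊((k + 3 : ℕ) : ℝ) * phi⌋ < ⌊(k : ℝ) * phi⌋ + 6 := by
    rw [Int.floor_lt]; push_cast; linarith
  omega

lemma floor_mul_phi_of_le {n : ℕ} (hn : n ≤ 10) :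
    ⌊(n : ℝ) * phi⌋ = (n : ℤ) * 89 / 55 := by
  obtain ⟨h1, h2⟩ := phi_bounds
  rw [Int.floor_eq_iff]
  interval_cases n <;> norm_num <;> (try constructor) <;> linarith

/-- The value sequence `n ↦ p⌊nφ⌋ + qn + r` written through its two gaps `a`, `b` and its
first value `c`, for indices small enough that `⌊nφ⌋ = ⌊89n/55⌋`. -/
def gapSeq (a b c : ℤ) (n : ℕ) : ℤ :=
  (a - b) * ((n : ℤ) * 89 / 55) + (2 * b - a) * n + (c - b)

lemma eq_succ_of_apply_eq_add_one {V : ℕ → ℤ} (hV : ∀ m n : ℕ, 1 ≤ m → m < n → V m < V n)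
    {k l : ℕ} (hk : 1 ≤ k) (hl : 1 ≤ l) (h : V l = V k + 1) : l = k + 1 := by
  rcases lt_trichotomy l (k + 1) with hlt | heq | hgt
  · rcases eq_or_lt_of_le (Nat.lt_succ_iff.mp hlt) with rfl | hlt
    · omega
    · have := hV l k hl hlt
      omega
  · exact heq
  · have h1 := hV k (k + 1) hk (by omega)
    have h2 := hV (k + 1) l (by omega) hgt
    omega

/-- Values of `p⌊nφ⌋ + qn + r` cannot contain four consecutive integers unless `p = 0`. -/
lemma not_four_consecutive {p q r : ℤ} (hp : p ≠ 0) {V : ℕ → ℤ}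
    (hV : ∀ n : ℕ, 1 ≤ n → V n = p * ⌊(n : ℝ) * phi⌋ + q * n + r)
    (hVmono : ∀ m n : ℕ, 1 ≤ m → m < n → V m < V n) (z : ℤ)
    (h : ∀ i : ℤ, 0 ≤ i → i ≤ 3 → ∃ n : ℕ, 1 ≤ n ∧ V n = z + i) : False := by
  obtain ⟨k, hk, h0⟩ := h 0 (by norm_num) (by norm_num)
  obtain ⟨l, hl, h1⟩ := h 1 (by norm_num) (by norm_num)
  obtain rfl := eq_succ_of_apply_eq_add_one hVmono hk hl (by omega)
  obtain ⟨l, hl2, h2⟩ := h 2 (by norm_num) (by norm_num)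
  obtain rfl := eq_succ_of_apply_eq_add_one hVmono hl hl2 (by omega)
  obtain ⟨l, hl3, h3⟩ := h 3 (by norm_num) (by norm_num)
  obtain rfl := eq_succ_of_apply_eq_add_one hVmono hl2 hl3 (by omega)
  rw [hV _ (by omega)] at h0 h1 h2 h3
  have f1 := floor_succ_mul_phi k
  have f2 := floor_succ_mul_phi (k + 1)
  have f3 := floor_succ_mul_phi (k + 1 + 1)
  have f4 := floor_add_three_mul_phi k
  rw [show k + 1 + 1 + 1 = k + 3 from rfl] at *
  generalize ⌊((k + 3 : ℕ) : ℝ) * phi⌋ = d at *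
  generalize ⌊((k + 1 + 1 : ℕ) : ℝ) * phi⌋ = c at *
  generalize ⌊((k + 1 : ℕ) : ℝ) * phi⌋ = b at *
  generalize ⌊(k : ℝ) * phi⌋ = a at *
  push_cast at h0 h1 h2 h3
  apply hp
  rcases f1 with rfl | rfl <;> rcases f2 with rfl | rfl <;> rcases f3 with rfl | rfl <;>
    first | omega | linarith

/-- If every positive integer not a value of `V` is a value of `W`, the gaps of `V` are at
most `4`. -/
lemma gap_le_four {s t u : ℤ} (hs : s ≠ 0) {V W : ℕ → ℤ}
    (hW : ∀ n : ℕ, 1 ≤ n → W n = s * ⌊(n : ℝ) * phi⌋ + t * n + u)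
    (hVmono : ∀ m n : ℕ, 1 ≤ m → m < n → V m < V n)
    (hWmono : ∀ m n : ℕ, 1 ≤ m → m < n → W m < W n)
    (hcover : ∀ z : ℤ, 0 < z → (∃ n : ℕ, 1 ≤ n ∧ V n = z) ∨ ∃ n : ℕ, 1 ≤ n ∧ W n = z)
    {n : ℕ} (hn : 1 ≤ n) (hpos : 0 < V n) : V (n + 1) - V n ≤ 4 := by
  by_contra! hgap
  refine not_four_consecutive hs hW hWmono (V n + 1) fun i hi0 hi3 => ?_
  refine (hcover (V n + 1 + i) (by omega)).resolve_left ?_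
  rintro ⟨m, hm, hVm⟩
  rcases lt_trichotomy m n with h | rfl | h
  · have := hVmono m n hm h
    omega
  · omega
  · rcases eq_or_lt_of_le (Nat.succ_le_of_lt h) with h | h
    · subst h
      simp only [Nat.succ_eq_add_one] at hVm
      omega
    · have := hVmono (n + 1) m (by omega) h
      omega

lemma le_of_strictMono_of_pos {V : ℕ → ℤ} (hV : ∀ m n : ℕ, 1 ≤ m → m < n → V m < V n)
    (hpos : 0 < V 1) {n : ℕ} (hn : 1 ≤ n) : (n : ℤ) ≤ V n := by
  induction n, hn using Nat.le_induction with
  | base => exact_mod_cast hpos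
  | succ k hk ih =>
    have := hV k (k + 1) hk (by omega)
    push_cast
    omega

lemma eq_gapSeq {p q r : ℤ} {V : ℕ → ℤ}
    (hV : ∀ n : ℕ, 1 ≤ n → V n = p * ⌊(n : ℝ) * phi⌋ + q * n + r) {n : ℕ} (hn : 1 ≤ n)
    (hn' : n ≤ 10) : V n = gapSeq (2 * p + q) (p + q) (p + q + r) n := by
  rw [hV n hn, floor_mul_phi_of_le hn', gapSeq]
  ring

/-- Among small gaps, every pair of sequences other than the two solutions collides or leaves
a hole within their first ten terms. -/
lemma gapSeq_collision_or_hole : ∀ a ∈ ([1, 2, 3, 4] : List ℤ), ∀ b ∈ ([1, 2, 3, 4] : List ℤ),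
    ∀ c ∈ ([1, 2, 3, 4] : List ℤ), ∀ d ∈ ([1, 2, 3, 4] : List ℤ), ∀ w ∈ ([1, 2, 3, 4] : List ℤ),
    a ≠ b → c ≠ d →
    (a = 2 ∧ b = 1 ∧ c = 3 ∧ d = 2 ∧ w = 2) ∨ (a = 1 ∧ b = 2 ∧ c = 4 ∧ d = 3 ∧ w = 3) ∨
    (∃ z ∈ [1, 2, 3, 4, 5, 6, 7, 8, 9, 10], ∀ n ∈ List.range' 1 z,
      gapSeq a b 1 n ≠ (z : ℕ) ∧ gapSeq c d w n ≠ (z : ℕ)) ∨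
    ∃ m ∈ [1, 2, 3, 4, 5, 6, 7, 8, 9, 10],
      ∃ n ∈ [1, 2, 3, 4, 5, 6, 7, 8, 9, 10], gapSeq a b 1 m = gapSeq c d w n := by
  decide +kernel

lemma image_eq_beattySeq {V : ℕ → ℤ} {f : ℤ → ℤ} (h : ∀ n : ℕ, 1 ≤ n → V n = f n) :
    {z : ℤ | ∃ n : ℕ, 1 ≤ n ∧ V n = z} = {x : ℤ | ∃ k > 0, f k = x} := by
  ext z
  constructor
  · rintro ⟨n, hn, rfl⟩
    exact ⟨n, by omega, (h n hn).symm⟩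
  · rintro ⟨k, hk, rfl⟩
    lift k to ℕ using hk.le
    exact ⟨k, by omega, h k (by omega)⟩

lemma complementaryPair_of_symmDiff {V W : ℕ → ℤ} (hpos : ∀ n : ℕ, 1 ≤ n → 0 < V n)
    (h : symmDiff {z : ℤ | ∃ n : ℕ, 1 ≤ n ∧ V n = z} {z : ℤ | ∃ n : ℕ, 1 ≤ n ∧ W n = z} =
      {z : ℤ | 0 < z}) : ComplementaryPair V W := by
  have hd : Disjoint {z : ℤ | ∃ n : ℕ, 1 ≤ n ∧ V n = z} {z : ℤ | ∃ n : ℕ, 1 ≤ n ∧ W n = z} := by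
    rw [Set.disjoint_left]
    rintro z ⟨n, hn, hz⟩ hW
    have hz' : z ∈ {z : ℤ | 0 < z} := hz ▸ hpos n hn
    rw [← h, Set.mem_symmDiff] at hz'
    rcases hz' with hmem | hmem
    · exact hmem.2 hW
    · exact hmem.2 ⟨n, hn, hz⟩
  refine ⟨hd, ?_⟩
  rw [← h]
  exact hd.symmDiff_eq_sup.symm

/-- For `α = φ`, the only nontrivial increasing solutions of the complementary pair
problem are `(p,q,r,s,t,u) = (1,0,0,1,1,0)` and `(p,q,r,s,t,u) = (−1,3,−1,1,2,0)`. -/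
theorem complementary_pairs_golden_mean (p q r s t u : ℤ) (hp : p ≠ 0) (hs : s ≠ 0)
    (V W : ℕ → ℤ)
    (hV : ∀ n : ℕ, 1 ≤ n → V n = p * ⌊(n : ℝ) * phi⌋ + q * n + r)
    (hW : ∀ n : ℕ, 1 ≤ n → W n = s * ⌊(n : ℝ) * phi⌋ + t * n + u)
    (hVmono : ∀ m n : ℕ, 1 ≤ m → m < n → V m < V n)
    (hWmono : ∀ m n : ℕ, 1 ≤ m → m < n → W m < W n)
    (hV1 : V 1 = 1) :
    ComplementaryPair V W ↔
      ((p, q, r, s, t, u) = (1, 0, 0, 1, 1, 0) ∨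
       (p, q, r, s, t, u) = (-1, 3, -1, 1, 2, 0)) := by
  have hVpos : ∀ n : ℕ, 1 ≤ n → 0 < V n := fun n hn => by
    have := le_of_strictMono_of_pos hVmono (by omega) hn
    omega
  simp only [Prod.mk.injEq]
  constructor
  · rintro ⟨hdisj, hunion⟩
    have hcover : ∀ z : ℤ, 0 < z →
        (∃ n : ℕ, 1 ≤ n ∧ V n = z) ∨ ∃ n : ℕ, 1 ≤ n ∧ W n = z := fun z hz => by
      have hz' : z ∈ {z : ℤ | 0 < z} := hz
      rw [← hunion] at hz'
      exact hz'
    have hWpos : ∀ n : ℕ, 1 ≤ n → 0 < W n := fun n hn => by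
      have : W n ∈ {z : ℤ | 0 < z} := hunion ▸ Or.inr ⟨n, hn, rfl⟩
      exact this
    have hW1 : W 1 ≤ 4 := by
      by_contra! h
      refine not_four_consecutive hp hV hVmono 1 fun i hi0 hi3 => ?_
      refine (hcover (1 + i) (by omega)).resolve_right ?_
      rintro ⟨m, hm, hWm⟩
      rcases eq_or_lt_of_le hm with rfl | hlt
      · omega
      · have := hWmono 1 m le_rfl hlt
        omega
    have hgV := fun n hn =>
      gap_le_four (n := n) hs hW hVmono hWmono hcover hn (hVpos n hn)
    have hgW := fun n hn =>
      gap_le_four (n := n) hp hV hWmono hVmono (fun z hz => (hcover z hz).symm) hn (hWpos n hn)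
    have gV1 := hgV 1 (by norm_num)
    have gV2 := hgV 2 (by norm_num)
    have gW1 := hgW 1 (by norm_num)
    have gW2 := hgW 2 (by norm_num)
    have mV1 := hVmono 1 2 (by norm_num) (by norm_num)
    have mV2 := hVmono 2 3 (by norm_num) (by norm_num)
    have mW1 := hWmono 1 2 (by norm_num) (by norm_num)
    have mW2 := hWmono 2 3 (by norm_num) (by norm_num)
    have pW1 := hWpos 1 le_rfl
    norm_num at gV1 gV2 gW1 gW2
    have eV := fun n h1 h2 => eq_gapSeq (n := n) hV h1 h2
    have eW := fun n h1 h2 => eq_gapSeq (n := n) hW h1 h2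
    have hr : p + q + r = 1 := by
      have := eV 1 (by norm_num) (by norm_num)
      norm_num [gapSeq] at this
      omega
    have key := gapSeq_collision_or_hole (2 * p + q) ?_ (p + q) ?_ (2 * s + t) ?_ (s + t) ?_
      (s + t + u) ?_ (by omega) (by omega)
    · rcases key with h | h | ⟨z, hz, h⟩ | ⟨m, hm, n, hn, h⟩
      · omega
      · omega
      · simp only [List.mem_cons, List.not_mem_nil, or_false] at hz
        rcases hcover z (by omega) with ⟨n, hn, hVn⟩ | ⟨n, hn, hWn⟩
        · have hle := le_of_strictMono_of_pos hVmono (by omega) hn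
          refine ((h n (List.mem_range'_1.mpr ⟨hn, by omega⟩)).1 ?_).elim
          rw [← hr, ← eV n hn (by omega), hVn]
        · have hle := le_of_strictMono_of_pos hWmono (by omega) hn
          refine ((h n (List.mem_range'_1.mpr ⟨hn, by omega⟩)).2 ?_).elim
          rw [← eW n hn (by omega), hWn]
      · simp only [List.mem_cons, List.not_mem_nil, or_false] at hm hn
        rw [← hr, ← eV m (by omega) (by omega), ← eW n (by omega) (by omega)] at h
        exact (Set.disjoint_left.mp hdisj ⟨m, by omega, rfl⟩ ⟨n, by omega, h.symm⟩).elim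
    all_goals
      rw [eV 1 (by norm_num) (by norm_num), eV 2 (by norm_num) (by norm_num)] at *
      rw [eV 3 (by norm_num) (by norm_num), eW 1 (by norm_num) (by norm_num),
        eW 2 (by norm_num) (by norm_num), eW 3 (by norm_num) (by norm_num)] at *
      norm_num [gapSeq] at *
      omega
  · rintro (⟨rfl, rfl, rfl, rfl, rfl, rfl⟩ | ⟨rfl, rfl, rfl, rfl, rfl, rfl⟩)
    · refine complementaryPair_of_symmDiff hVpos ?_
      have hc : phi.HolderConjugate (phi + 1) := by
        rw [Real.holderConjugate_iff]
        have := phi_bounds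
        refine ⟨by linarith, ?_⟩
        have h0 : phi ≠ 0 := by linarith
        have h1 : phi + 1 ≠ 0 := by linarith
        field_simp
        linarith [phi_mul_self]
      rw [← irrational_phi.beattySeq_symmDiff_beattySeq_pos hc,
        image_eq_beattySeq (f := beattySeq phi), image_eq_beattySeq (f := beattySeq (phi + 1))]
      · intro n hn
        rw [hW n hn, beattySeq, mul_add, mul_one, Int.cast_natCast, Int.floor_add_natCast]
        ring
      · intro n hn
        rw [hV n hn, beattySeq, Int.cast_natCast]
        ring
    · refine complementaryPair_of_symmDiff hVpos ?_
      have hc : (3 - phi).HolderConjugate (phi + 2) := by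
        rw [Real.holderConjugate_iff]
        have := phi_bounds
        refine ⟨by linarith, ?_⟩
        have h0 : 3 - phi ≠ 0 := by linarith
        have h1 : phi + 2 ≠ 0 := by linarith
        field_simp
        linarith [phi_mul_self]
      rw [← beattySeq'_symmDiff_beattySeq_pos hc,
        image_eq_beattySeq (f := beattySeq' (3 - phi)),
        image_eq_beattySeq (f := beattySeq (phi + 2))]
      · intro n hn
        have : ((n : ℤ) : ℝ) * (phi + 2) = n * phi + ((2 * n : ℤ) : ℝ) := by push_cast; ring
        rw [hW n hn, beattySeq, this, Int.floor_add_intCast]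
        ring
      · intro n hn
        have : ((n : ℤ) : ℝ) * (3 - phi) = -(n * phi) + ((3 * n : ℤ) : ℝ) := by push_cast; ring
        rw [hV n hn, beattySeq', this, Int.ceil_add_intCast, Int.ceil_neg]
        ring
end

section
/- Let w = w₁w₂…w_m (m ≥ 1) be a finite word over {0,1} that occurs in the Fibonacci word, i.e., there exists i ≥ 1 with x_F(i + j − 1) = w_j for all 1 ≤ j ≤ m. Then the set S = {i ≥ 1 : x_F(i + j − 1) = w_j for all 1 ≤ j ≤ m} of occurrence positions of w is infinite, and there exist integers p, q, r such that for every n ≥ 1 the n-th smallest element of S equals p⌊nφ⌋ + qn + r. -/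
/-- The Fibonacci word `x_F(n) = 2 − (⌊(n+1)φ⌋ − ⌊nφ⌋)`, for `n ≥ 1`. -/
noncomputable def xF (n : ℕ) : ℤ := 2 - (⌊((n : ℝ) + 1) * phi⌋ - ⌊(n : ℝ) * phi⌋)

lemma phi_sq : phi ^ 2 = phi + 1 := by
  have h : Real.sqrt 5 ^ 2 = 5 := Real.sq_sqrt (by norm_num)
  unfold phi
  linear_combination h / 4

lemma one_lt_phi : 1 < phi := by
  have h : (2 : ℝ) < Real.sqrt 5 := Real.lt_sqrt_of_sq_lt (by norm_num)
  unfold phi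
  linarith

lemma phi_lt_two : phi < 2 := by
  have h : Real.sqrt 5 < 3 := (Real.sqrt_lt' (by norm_num)).2 (by norm_num)
  unfold phi
  linarith

/-- The lower Wythoff sequence `⌊nφ⌋`. -/
noncomputable def lowerWythoff (n : ℕ) : ℕ := ⌊(n : ℝ) * phi⌋₊

/-- The upper Wythoff sequence `⌊nφ²⌋ = ⌊nφ⌋ + n`. -/
noncomputable def upperWythoff (n : ℕ) : ℕ := lowerWythoff n + n

lemma lowerWythoff_cast (n : ℕ) : (lowerWythoff n : ℤ) = ⌊(n : ℝ) * phi⌋ :=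
  Int.natCast_floor_eq_floor (mul_nonneg n.cast_nonneg (by linarith [one_lt_phi]))

lemma lowerWythoff_eq_iff (n k : ℕ) :
    lowerWythoff n = k ↔ (k : ℝ) ≤ n * phi ∧ (n : ℝ) * phi < k + 1 :=
  Nat.floor_eq_iff (mul_nonneg n.cast_nonneg (by linarith [one_lt_phi]))

lemma lowerWythoff_lt {n : ℕ} (hn : 1 ≤ n) : (lowerWythoff n : ℝ) < n * phi := by
  refine lt_of_le_of_ne ((lowerWythoff_eq_iff n _).1 rfl).1 fun h => ?_
  exact (irrational_phi.natCast_mul (by omega : n ≠ 0)).ne_nat _ h.symm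

lemma lowerWythoff_one : lowerWythoff 1 = 1 := by
  rw [lowerWythoff_eq_iff]
  push_cast
  constructor <;> linarith [one_lt_phi, phi_lt_two]

lemma le_lowerWythoff (n : ℕ) : n ≤ lowerWythoff n :=
  Nat.le_floor (le_mul_of_one_le_right n.cast_nonneg one_lt_phi.le)

lemma xF_eq (n : ℕ) : xF n = 2 - ((lowerWythoff (n + 1) : ℤ) - lowerWythoff n) := by
  simp only [xF, lowerWythoff_cast, Nat.cast_add, Nat.cast_one]

lemma xF_eq_zero_or_one (n : ℕ) : xF n = 0 ∨ xF n = 1 := by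
  obtain ⟨h1, h2⟩ := (lowerWythoff_eq_iff n _).1 rfl
  obtain ⟨h3, h4⟩ := (lowerWythoff_eq_iff (n + 1) _).1 rfl
  push_cast at h3 h4
  have h5 : lowerWythoff n < lowerWythoff (n + 1) := by
    have : (lowerWythoff n : ℝ) < lowerWythoff (n + 1) := by linarith [one_lt_phi]
    exact_mod_cast this
  have h6 : lowerWythoff (n + 1) < lowerWythoff n + 3 := by
    have : (lowerWythoff (n + 1) : ℝ) < lowerWythoff n + 3 := by linarith [phi_lt_two]
    exact_mod_cast this
  rw [xF_eq]
  omega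

lemma lowerWythoff_succ_of_zero {n : ℕ} (h : xF n = 0) :
    lowerWythoff (n + 1) = lowerWythoff n + 2 := by
  have := xF_eq n
  omega

lemma lowerWythoff_succ_of_one {n : ℕ} (h : xF n = 1) :
    lowerWythoff (n + 1) = lowerWythoff n + 1 := by
  have := xF_eq n
  omega

lemma lowerWythoff_lowerWythoff {n : ℕ} (hn : 1 ≤ n) :
    lowerWythoff (lowerWythoff n) + 1 = lowerWythoff n + n := by
  have h1 := lowerWythoff_lt hn
  have h2 := ((lowerWythoff_eq_iff n _).1 rfl).2
  have hA : lowerWythoff (lowerWythoff n) = lowerWythoff n + n - 1 := by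
    rw [lowerWythoff_eq_iff, Nat.cast_sub (by omega)]
    push_cast
    constructor <;> nlinarith [phi_sq, one_lt_phi, phi_lt_two]
  omega

lemma lowerWythoff_lowerWythoff_add_one {n : ℕ} (hn : 1 ≤ n) :
    lowerWythoff (lowerWythoff n + 1) = lowerWythoff n + n + 1 := by
  have h1 := lowerWythoff_lt hn
  have h2 := ((lowerWythoff_eq_iff n _).1 rfl).2
  rw [lowerWythoff_eq_iff]
  push_cast
  constructor <;> nlinarith [phi_sq, one_lt_phi, phi_lt_two]

lemma xF_lowerWythoff {n : ℕ} (hn : 1 ≤ n) : xF (lowerWythoff n) = 0 := by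
  have h1 := lowerWythoff_lowerWythoff hn
  have h2 := lowerWythoff_lowerWythoff_add_one hn
  rw [xF_eq]
  omega

lemma xF_lowerWythoff_add_one {n : ℕ} (hn : 1 ≤ n) : xF (lowerWythoff n + 1) = 1 - xF n := by
  have h1 := lowerWythoff_lowerWythoff_add_one hn
  have h2 := lowerWythoff_lowerWythoff (Nat.le_add_left 1 n)
  have h3 := lowerWythoff_lowerWythoff_add_one (Nat.le_add_left 1 n)
  rw [xF_eq (lowerWythoff n + 1)]
  rcases xF_eq_zero_or_one n with h | h
  · rw [lowerWythoff_succ_of_zero h] at h2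
    simp only [add_assoc, Nat.reduceAdd] at h2 ⊢
    omega
  · rw [lowerWythoff_succ_of_one h] at h3
    omega

lemma upperWythoff_eq {n : ℕ} (hn : 1 ≤ n) :
    upperWythoff n = lowerWythoff (lowerWythoff n) + 1 :=
  (lowerWythoff_lowerWythoff hn).symm

lemma xF_upperWythoff {n : ℕ} (hn : 1 ≤ n) : xF (upperWythoff n) = 1 := by
  rw [upperWythoff_eq hn, xF_lowerWythoff_add_one (hn.trans (le_lowerWythoff n)),
    xF_lowerWythoff hn, sub_zero]

lemma upperWythoff_add_one {n : ℕ} (hn : 1 ≤ n) :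
    upperWythoff n + 1 = lowerWythoff (lowerWythoff n + 1) :=
  (lowerWythoff_lowerWythoff_add_one hn).symm

lemma xF_upperWythoff_add_one {n : ℕ} (hn : 1 ≤ n) : xF (upperWythoff n + 1) = 0 := by
  rw [upperWythoff_add_one hn, xF_lowerWythoff (Nat.le_add_left 1 _)]

lemma xF_upperWythoff_add_two {n : ℕ} (hn : 1 ≤ n) : xF (upperWythoff n + 2) = xF n := by
  change xF (upperWythoff n + 1 + 1) = xF n
  rw [upperWythoff_add_one hn, xF_lowerWythoff_add_one (Nat.le_add_left 1 _),
    xF_lowerWythoff_add_one hn, sub_sub_cancel]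

lemma exists_wythoff {k : ℕ} (hk : 1 ≤ k) :
    (∃ n, 1 ≤ n ∧ k = lowerWythoff n) ∨ ∃ n, 1 ≤ n ∧ k = upperWythoff n := by
  induction k using Nat.strong_induction_on with
  | _ k ih =>
    obtain rfl | hk1 := hk.eq_or_lt
    · exact Or.inl ⟨1, le_rfl, lowerWythoff_one.symm⟩
    obtain ⟨l, rfl⟩ : ∃ l, k = l + 1 := ⟨k - 1, by omega⟩
    rcases ih l (by omega) (by omega) with ⟨n, hn, rfl⟩ | ⟨n, hn, rfl⟩
    · rcases xF_eq_zero_or_one n with h | h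
      · rcases ih n (Nat.lt_succ_of_le (le_lowerWythoff n)) hn with ⟨j, hj, rfl⟩ | ⟨j, hj, rfl⟩
        · exact Or.inr ⟨j, hj, (upperWythoff_eq hj).symm⟩
        · rw [xF_upperWythoff hj] at h
          exact absurd h one_ne_zero
      · exact Or.inl ⟨n + 1, by omega, (lowerWythoff_succ_of_one h).symm⟩
    · exact Or.inl ⟨_, Nat.le_add_left 1 _, upperWythoff_add_one hn⟩

lemma eq_lowerWythoff_of_xF {k : ℕ} (hk : 1 ≤ k) (h : xF k = 0) :
    ∃ n, 1 ≤ n ∧ k = lowerWythoff n := by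
  refine (exists_wythoff hk).resolve_right ?_
  rintro ⟨n, hn, rfl⟩
  simp [xF_upperWythoff hn] at h

lemma eq_upperWythoff_of_xF {k : ℕ} (hk : 1 ≤ k) (h : xF k = 1) :
    ∃ n, 1 ≤ n ∧ k = upperWythoff n := by
  refine (exists_wythoff hk).resolve_left ?_
  rintro ⟨n, hn, rfl⟩
  simp [xF_lowerWythoff hn] at h

/-- The sequence `V` of positions (indexed from `1`) has gaps `a` and `b` ordered like the letters
`0` and `1` of the Fibonacci word, the same `t` letters are read from each of these positions, and
the letter after them is `c₀` or `c₁` according to the letters of the Fibonacci word. -/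
structure IsReturnSequence (V : ℕ → ℕ) (t a b : ℕ) (c₀ c₁ : ℤ) : Prop where
  one_le : 1 ≤ V 1
  a_pos : 1 ≤ a
  b_pos : 1 ≤ b
  a_le : a ≤ t + 1
  b_le : b ≤ t + 1
  succ_of_zero : ∀ n, 1 ≤ n → xF n = 0 → V (n + 1) = V n + a
  succ_of_one : ∀ n, 1 ≤ n → xF n = 1 → V (n + 1) = V n + b
  const : ∀ j, j < t → ∀ n, 1 ≤ n → xF (V n + j) = xF (V 1 + j)
  next_of_zero : ∀ n, 1 ≤ n → xF n = 0 → xF (V n + t) = c₀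
  next_of_one : ∀ n, 1 ≤ n → xF n = 1 → xF (V n + t) = c₁
  ne : c₀ ≠ c₁

lemma isReturnSequence_id : IsReturnSequence id 0 1 1 0 1 where
  one_le := le_rfl
  a_pos := le_rfl
  b_pos := le_rfl
  a_le := le_rfl
  b_le := le_rfl
  succ_of_zero _ _ _ := rfl
  succ_of_one _ _ _ := rfl
  const _ hj := absurd hj (Nat.not_lt_zero _)
  next_of_zero _ _ h := h
  next_of_one _ _ h := h
  ne := zero_ne_one

namespace IsReturnSequence

variable {V : ℕ → ℕ} {t a b : ℕ} {c₀ c₁ : ℤ}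

lemma lt_succ (h : IsReturnSequence V t a b c₀ c₁) {n : ℕ} (hn : 1 ≤ n) : V n < V (n + 1) := by
  have ha := h.a_pos
  have hb := h.b_pos
  rcases xF_eq_zero_or_one n with h0 | h1
  · rw [h.succ_of_zero n hn h0]
    omega
  · rw [h.succ_of_one n hn h1]
    omega

lemma one_le_apply (h : IsReturnSequence V t a b c₀ c₁) {n : ℕ} (hn : 1 ≤ n) : 1 ≤ V n := by
  induction n, hn using Nat.le_induction with
  | base => exact h.one_le
  | succ n hn ih => exact ih.trans (h.lt_succ hn).le

lemma comp_lowerWythoff (h : IsReturnSequence V t a b c₀ c₁) :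
    IsReturnSequence (V ∘ lowerWythoff) (t + a) (a + b) a c₁ c₀ := by
  have pos {n : ℕ} (hn : 1 ≤ n) : 1 ≤ lowerWythoff n := hn.trans (le_lowerWythoff n)
  have hV {n : ℕ} (hn : 1 ≤ n) : V (lowerWythoff n + 1) = V (lowerWythoff n) + a :=
    h.succ_of_zero _ (pos hn) (xF_lowerWythoff hn)
  have ha := h.a_pos
  have ha' := h.a_le
  have hb' := h.b_le
  have hshift {n : ℕ} (hn : 1 ≤ n) (j : ℕ) :
      xF (V (lowerWythoff n) + (j + a)) = xF (V (lowerWythoff n + 1) + j) := by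
    rw [hV hn]
    congr 1
    ring
  refine ⟨h.one_le_apply (pos le_rfl), by omega, ha, by omega, by omega, fun n hn h0 => ?_,
    fun n hn h1 => ?_, fun j hj n hn => ?_, fun n hn h0 => ?_, fun n hn h1 => ?_, h.ne.symm⟩
  · have h1 := xF_lowerWythoff_add_one hn
    rw [h0, sub_zero] at h1
    have h2 := h.succ_of_one _ (Nat.le_add_left 1 _) h1
    rw [hV hn] at h2
    simp only [Function.comp_apply, lowerWythoff_succ_of_zero h0]
    rw [← add_assoc]
    exact h2
  · simp only [Function.comp_apply, lowerWythoff_succ_of_one h1, hV hn]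
  · simp only [Function.comp_apply]
    rcases lt_trichotomy j t with hjt | rfl | hjt
    · rw [h.const j hjt _ (pos hn), h.const j hjt _ (pos le_rfl)]
    · rw [h.next_of_zero _ (pos hn) (xF_lowerWythoff hn),
        h.next_of_zero _ (pos le_rfl) (xF_lowerWythoff le_rfl)]
    · obtain ⟨i, rfl⟩ : ∃ i, j = i + a := ⟨j - a, by omega⟩
      rw [hshift hn, hshift le_rfl]
      exact (h.const i (by omega) _ (Nat.le_add_left 1 _)).trans
        (h.const i (by omega) _ (Nat.le_add_left 1 _)).symm
  · simp only [Function.comp_apply]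
    rw [hshift hn]
    exact h.next_of_one _ (Nat.le_add_left 1 _) (by rw [xF_lowerWythoff_add_one hn, h0, sub_zero])
  · simp only [Function.comp_apply]
    rw [hshift hn]
    exact h.next_of_zero _ (Nat.le_add_left 1 _) (by rw [xF_lowerWythoff_add_one hn, h1, sub_self])

lemma comp_upperWythoff (h : IsReturnSequence V t a b c₀ c₁) :
    IsReturnSequence (V ∘ upperWythoff) (t + a + b) (2 * a + b) (a + b) c₀ c₁ := by
  have pos {n : ℕ} (hn : 1 ≤ n) : 1 ≤ upperWythoff n := hn.trans (Nat.le_add_left _ _)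
  have hV {n : ℕ} (hn : 1 ≤ n) : V (upperWythoff n + 1) = V (upperWythoff n) + b :=
    h.succ_of_one _ (pos hn) (xF_upperWythoff hn)
  have hV' {n : ℕ} (hn : 1 ≤ n) : V (upperWythoff n + 2) = V (upperWythoff n) + b + a := by
    rw [← hV hn]
    exact h.succ_of_zero _ (Nat.le_add_left 1 _) (xF_upperWythoff_add_one hn)
  have ha := h.a_pos
  have hb := h.b_pos
  have ha' := h.a_le
  have hb' := h.b_le
  have hshift {n : ℕ} (hn : 1 ≤ n) (j : ℕ) :
      xF (V (upperWythoff n) + (j + b)) = xF (V (upperWythoff n + 1) + j) := by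
    rw [hV hn]
    congr 1
    ring
  have hshift' {n : ℕ} (hn : 1 ≤ n) (j : ℕ) :
      xF (V (upperWythoff n) + (j + a + b)) = xF (V (upperWythoff n + 2) + j) := by
    rw [hV' hn]
    congr 1
    ring
  refine ⟨h.one_le_apply (pos le_rfl), by omega, by omega, by omega, by omega, fun n hn h0 => ?_,
    fun n hn h1 => ?_, fun j hj n hn => ?_, fun n hn h0 => ?_, fun n hn h1 => ?_, h.ne⟩
  · have h1 := h.succ_of_zero _ (Nat.le_add_left 1 _) ((xF_upperWythoff_add_two hn).trans h0)
    have h2 : upperWythoff (n + 1) = upperWythoff n + 2 + 1 := by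
      simp only [upperWythoff, lowerWythoff_succ_of_zero h0]
      ring
    simp only [Function.comp_apply, h2]
    rw [h1, hV' hn]
    ring
  · have h2 : upperWythoff (n + 1) = upperWythoff n + 2 := by
      simp only [upperWythoff, lowerWythoff_succ_of_one h1]
      ring
    simp only [Function.comp_apply, h2]
    rw [hV' hn]
    ring
  · simp only [Function.comp_apply]
    rcases lt_trichotomy j t with hjt | rfl | hjt
    · rw [h.const j hjt _ (pos hn), h.const j hjt _ (pos le_rfl)]
    · rw [h.next_of_one _ (pos hn) (xF_upperWythoff hn),
        h.next_of_one _ (pos le_rfl) (xF_upperWythoff le_rfl)]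
    obtain ⟨i, rfl⟩ : ∃ i, j = i + b := ⟨j - b, by omega⟩
    rcases lt_trichotomy i t with hit | rfl | hit
    · rw [hshift hn, hshift le_rfl]
      exact (h.const i hit _ (Nat.le_add_left 1 _)).trans
        (h.const i hit _ (Nat.le_add_left 1 _)).symm
    · rw [hshift hn, hshift le_rfl,
        h.next_of_zero _ (Nat.le_add_left 1 _) (xF_upperWythoff_add_one hn),
        h.next_of_zero _ (Nat.le_add_left 1 _) (xF_upperWythoff_add_one le_rfl)]
    · obtain ⟨l, rfl⟩ : ∃ l, i = l + a := ⟨i - a, by omega⟩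
      rw [hshift' hn, hshift' le_rfl]
      exact (h.const l (by omega) _ (Nat.le_add_left 1 _)).trans
        (h.const l (by omega) _ (Nat.le_add_left 1 _)).symm
  · simp only [Function.comp_apply]
    rw [hshift' hn]
    exact h.next_of_zero _ (Nat.le_add_left 1 _) ((xF_upperWythoff_add_two hn).trans h0)
  · simp only [Function.comp_apply]
    rw [hshift' hn]
    exact h.next_of_one _ (Nat.le_add_left 1 _) ((xF_upperWythoff_add_two hn).trans h1)

lemma eq_beatty (h : IsReturnSequence V t a b c₀ c₁) {n : ℕ} (hn : 1 ≤ n) :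
    (V n : ℤ) = (a - b) * ⌊(n : ℝ) * phi⌋ + (2 * b - a) * n + (V 1 - b) := by
  simp only [← lowerWythoff_cast]
  induction n, hn using Nat.le_induction with
  | base =>
    rw [lowerWythoff_one]
    push_cast
    ring
  | succ n hn ih =>
    rcases xF_eq_zero_or_one n with h0 | h1
    · rw [h.succ_of_zero n hn h0, lowerWythoff_succ_of_zero h0]
      push_cast
      rw [ih]
      ring
    · rw [h.succ_of_one n hn h1, lowerWythoff_succ_of_one h1]
      push_cast
      rw [ih]
      ring

end IsReturnSequence

/-- The word `w₁…w_m` occurs in the Fibonacci word at position `i`. -/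
def OccursAt (m : ℕ) (w : ℕ → ℤ) (i : ℕ) : Prop :=
  1 ≤ i ∧ ∀ j : ℕ, 1 ≤ j → j ≤ m → xF (i + j - 1) = w j

lemma occursAt_succ {m : ℕ} {w : ℕ → ℤ} {i : ℕ} :
    OccursAt (m + 1) w i ↔ OccursAt m w i ∧ xF (i + m) = w (m + 1) := by
  constructor
  · rintro ⟨hi, h⟩
    exact ⟨⟨hi, fun j h1 h2 => h j h1 (by omega)⟩, h (m + 1) (by omega) le_rfl⟩
  · rintro ⟨⟨hi, h⟩, hm⟩
    refine ⟨hi, fun j h1 h2 => ?_⟩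
    obtain rfl | h3 := h2.eq_or_lt
    · exact hm
    · exact h j h1 (by omega)

lemma exists_isReturnSequence (m : ℕ) (w : ℕ → ℤ) (hocc : ∃ i, OccursAt m w i) :
    ∃ V t a b c₀ c₁, IsReturnSequence V t a b c₀ c₁ ∧ m ≤ t ∧
      ∀ i, OccursAt m w i ↔ ∃ n, 1 ≤ n ∧ i = V n := by
  induction m with
  | zero =>
    refine ⟨id, 0, 1, 1, 0, 1, isReturnSequence_id, le_rfl, fun i => ?_⟩
    exact ⟨fun h => ⟨i, h.1, rfl⟩, fun ⟨n, hn, hi⟩ => ⟨hi ▸ hn, fun j h1 h2 => by omega⟩⟩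
  | succ m ih =>
    obtain ⟨i₀, hi₀⟩ := hocc
    rw [occursAt_succ] at hi₀
    obtain ⟨V, t, a, b, c₀, c₁, h, hmt, hV⟩ := ih ⟨i₀, hi₀.1⟩
    obtain ⟨n₀, hn₀, rfl⟩ := (hV i₀).1 hi₀.1
    have ha := h.a_pos
    simp only [occursAt_succ, hV]
    obtain rfl | hlt := hmt.eq_or_lt
    · rcases xF_eq_zero_or_one n₀ with h0 | h1
      · have hw : c₀ = w (m + 1) := (h.next_of_zero n₀ hn₀ h0).symm.trans hi₀.2
        refine ⟨_, _, _, _, _, _, h.comp_lowerWythoff, by omega, fun i => ⟨?_, ?_⟩⟩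
        · rintro ⟨⟨n, hn, rfl⟩, hnext⟩
          have hn0 : xF n = 0 := (xF_eq_zero_or_one n).resolve_right fun hn1 =>
            h.ne (hw.trans (hnext.symm.trans (h.next_of_one n hn hn1)))
          obtain ⟨k, hk, rfl⟩ := eq_lowerWythoff_of_xF hn hn0
          exact ⟨k, hk, rfl⟩
        · rintro ⟨k, hk, rfl⟩
          have hk' := hk.trans (le_lowerWythoff k)
          exact ⟨⟨_, hk', rfl⟩, (h.next_of_zero _ hk' (xF_lowerWythoff hk)).trans hw⟩
      · have hw : c₁ = w (m + 1) := (h.next_of_one n₀ hn₀ h1).symm.trans hi₀.2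
        refine ⟨_, _, _, _, _, _, h.comp_upperWythoff, by omega, fun i => ⟨?_, ?_⟩⟩
        · rintro ⟨⟨n, hn, rfl⟩, hnext⟩
          have hn1 : xF n = 1 := (xF_eq_zero_or_one n).resolve_left fun hn0 =>
            h.ne ((h.next_of_zero n hn hn0).symm.trans (hnext.trans hw.symm))
          obtain ⟨k, hk, rfl⟩ := eq_upperWythoff_of_xF hn hn1
          exact ⟨k, hk, rfl⟩
        · rintro ⟨k, hk, rfl⟩
          have hk' : 1 ≤ upperWythoff k := hk.trans (Nat.le_add_left _ _)
          exact ⟨⟨_, hk', rfl⟩, (h.next_of_one _ hk' (xF_upperWythoff hk)).trans hw⟩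
    · refine ⟨V, t, a, b, c₀, c₁, h, hlt, fun i => ⟨And.left, ?_⟩⟩
      rintro ⟨n, hn, rfl⟩
      refine ⟨⟨n, hn, rfl⟩, ?_⟩
      rw [h.const m hlt n hn, ← h.const m hlt n₀ hn₀, hi₀.2]

/-- If `w = w₁…w_m` is a word over `{0,1}` occurring in the Fibonacci word, then the set
of occurrence positions of `w` is infinite and its increasing enumeration is a
generalized Beatty sequence `p⌊nφ⌋ + qn + r`. -/
theorem occurrences_are_gbs (m : ℕ) (hm : 1 ≤ m) (w : ℕ → ℤ)
    (hw01 : ∀ j : ℕ, 1 ≤ j → j ≤ m → w j = 0 ∨ w j = 1)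
    (hocc : ∃ i : ℕ, 1 ≤ i ∧ ∀ j : ℕ, 1 ≤ j → j ≤ m → xF (i + j - 1) = w j) :
    {i : ℕ | 1 ≤ i ∧ ∀ j : ℕ, 1 ≤ j → j ≤ m → xF (i + j - 1) = w j}.Infinite ∧
    ∃ p q r : ℤ, ∀ n : ℕ, 1 ≤ n →
      ((Nat.nth (fun i => 1 ≤ i ∧ ∀ j : ℕ, 1 ≤ j → j ≤ m → xF (i + j - 1) = w j)
          (n - 1) : ℕ) : ℤ) = p * ⌊(n : ℝ) * phi⌋ + q * n + r := by
  change {i | OccursAt m w i}.Infinite ∧ ∃ p q r : ℤ, ∀ n : ℕ, 1 ≤ n →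
    ((Nat.nth (OccursAt m w) (n - 1) : ℕ) : ℤ) = p * ⌊(n : ℝ) * phi⌋ + q * n + r
  obtain ⟨V, t, a, b, c₀, c₁, h, -, hV⟩ := exists_isReturnSequence m w hocc
  have hmono : StrictMono fun n => V (n + 1) :=
    strictMono_nat_of_lt_succ fun n => h.lt_succ (Nat.le_add_left 1 n)
  have hmem (n : ℕ) : OccursAt m w (V (n + 1)) := (hV _).2 ⟨n + 1, Nat.le_add_left 1 n, rfl⟩
  have hinf : {i | OccursAt m w i}.Infinite :=
    Set.infinite_of_injective_forall_mem hmono.injective hmem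
  refine ⟨hinf, a - b, 2 * b - a, V 1 - b, fun n hn => ?_⟩
  have hnth := Nat.nth_comp_of_strictMono (n := n - 1) hmono
    (fun k hk => by
      obtain ⟨l, hl, rfl⟩ := (hV k).1 hk
      exact ⟨l - 1, by simp only [Nat.sub_add_cancel hl]⟩)
    (fun hfin => absurd hfin hinf)
  simp only [hmem, Nat.nth_true, Nat.sub_add_cancel hn] at hnth
  rw [← hnth, h.eq_beatty hn]
end
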